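/- arXiv:math/0205153 — 2 statements merged into one kernel-verified Lean document; each statement's English description precedes it below -/
import Mathlib

section
/- Let d ≥ 2 and suppose E ⊆ (0,∞) satisfies the convexity assumption: for each k ∈ ℤ, E^k = {t^k_ν : ν ≥ 1} where (t^k_ν)_{ν≥1} is a monotone sequence contained in [2^k, 2^{k+1}] such that the sequence of differences (t^k_{ν+1} − t^k_ν)_{ν≥1} is also monotone. Suppose for some β > 0 and some constant C one has N(E^k, 2^{k−n}) ≤ C 2^n (1+n)^{−β} for all k ∈ ℤ and all integers n ≥ 0. Then E satisfies the regularity hypothesis (R_p) for every p > 1 + 1/((d−1)(β+1)), and moreover E satisfies the regularity hypothesis (R̃_{p_d}) with p_d = d/(d−1). -/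
open MeasureTheory Metric Set Filter
open scoped ENNReal NNReal Topology

noncomputable section

abbrev Ed (d : ℕ) := EuclideanSpace ℝ (Fin d)

/-- The rotation-invariant probability measure on the unit sphere. -/
def sphereProb (d : ℕ) : Measure (sphere (0 : Ed d) 1) :=
  ((volume : Measure (Ed d)).toSphere Set.univ)⁻¹ • (volume : Measure (Ed d)).toSphere

/-- Spherical mean `A_t f`. -/
def sphMean (d : ℕ) (t : ℝ) (f : Ed d → ℂ) (x : Ed d) : ℂ :=
  ∫ y : sphere (0 : Ed d) 1, f (x - t • (y : Ed d)) ∂(sphereProb d)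

/-- Spherical maximal function, with values in `ℝ≥0∞`. -/
def maxFn (d : ℕ) (E : Set ℝ) (f : Ed d → ℂ) (x : Ed d) : ℝ≥0∞ :=
  ⨆ t ∈ E, (‖sphMean d t f x‖₊ : ℝ≥0∞)

/-- `N(S,δ)`: minimal number of intervals of length `δ` needed to cover `S`
(with the value `1` for the empty set). -/
def covN (S : Set ℝ) (δ : ℝ) : ℕ :=
  max 1 (sInf {n : ℕ | ∃ c : Fin n → ℝ, S ⊆ ⋃ i, Set.Icc (c i) (c i + δ)})

def Ek (E : Set ℝ) (k : ℤ) : Set ℝ := E ∩ Set.Ico ((2:ℝ)^k) ((2:ℝ)^(k+1))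

/-- weak type (p,p) for the spherical maximal operator. -/
def WeakTypePP (d : ℕ) (E : Set ℝ) (p : ℝ) : Prop :=
  ∃ C : ℝ, ∀ f : Ed d → ℂ, Continuous f → HasCompactSupport f → ∀ a : ℝ, 0 < a →
    volume {x | ENNReal.ofReal a < maxFn d E f x} ≤
      ENNReal.ofReal (C * a ^ (-p) * ∫ x, ‖f x‖ ^ p)

/-- `J` is equally spaced with width `δ` and possible deviation `C`. -/
def EquallySpaced (J : Set ℝ) (δ C : ℝ) : Prop :=
  ∀ t ∈ J, C⁻¹ * δ ≤ infDist t (J \ {t}) ∧ infDist t (J \ {t}) ≤ C * δ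

/-- The set of endpoints `𝒟^k` of a family of sets. -/
def Dk (𝒥 : ℤ → Set (Set ℝ)) (k : ℤ) : Set ℝ := ⋃ J ∈ 𝒥 k, {sInf J, sSup J}

/-- `𝒥^k_μ`: the members of `𝒥^k` which are equally spaced with width `2^{k-μ}`
and possible deviation `C`. -/
def Jmu (𝒥 : ℤ → Set (Set ℝ)) (C : ℝ) (k : ℤ) (μ : ℕ) : Set (Set ℝ) :=
  {J ∈ 𝒥 k | EquallySpaced J ((2:ℝ) ^ (k - (μ:ℤ))) C}

/-- Conditions (a) and (b) of the regularity hypotheses `(R_p)` and `(R̃_p)`. -/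
def RegFamilyCore (E : Set ℝ) (d : ℕ) (p : ℝ) (𝒥 : ℤ → Set (Set ℝ)) (C : ℝ) : Prop :=
  1 < C ∧
  (∀ k : ℤ, ∀ J ∈ 𝒥 k, J ⊆ Set.Icc ((2:ℝ)^k) ((2:ℝ)^(k+1))) ∧
  (∀ k : ℤ, Ek E k ⊆ ⋃ J ∈ 𝒥 k, J) ∧
  (∀ k : ℤ, ∀ J ∈ 𝒥 k, ∃ δ : ℝ, 0 < δ ∧ EquallySpaced J δ C) ∧
  (∃ ω : ℕ → ℝ, (∀ j, 0 < ω j) ∧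
    (∑' j : ℕ, ENNReal.ofReal ((ω j) ^ (-(p / (p - 1))))) ≤ 1 ∧
    ∃ C0 : ℝ, ∀ k : ℤ,
      (∑' j : ℕ, ENNReal.ofReal ((ω j) ^ p) * (covN (Dk 𝒥 (k + j)) ((2:ℝ) ^ k) : ℝ≥0∞) *
          ENNReal.ofReal ((2:ℝ) ^ (-(j:ℝ) * ((d:ℝ) - 1) * (p - 1)))) ≤ ENNReal.ofReal C0)

/-- Condition (c) of the regularity hypothesis `(R_p)`. -/
def CardCond (E : Set ℝ) (𝒥 : ℤ → Set (Set ℝ)) (C : ℝ) : Prop :=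
  ∃ C1 : ℝ, 1 < C1 ∧ ∀ k : ℤ, ∀ μ : ℕ,
    (∑' J : (Jmu 𝒥 C k μ), ((J : Set ℝ).ncard : ℝ≥0∞)) ≤
      ENNReal.ofReal C1 * (covN (Ek E k) ((2:ℝ) ^ (k - (μ:ℤ))) : ℝ≥0∞)

/-- Condition (c̃) of the regularity hypothesis `(R̃_{p_d})`. -/
def CardCondTilde (E : Set ℝ) (𝒥 : ℤ → Set (Set ℝ)) (C : ℝ) : Prop :=
  ∃ C1 : ℝ, 1 < C1 ∧ ∀ k : ℤ, ∀ n : ℕ,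
    (∑' μ : {μ : ℕ // n ≤ μ},
        ENNReal.ofReal ((2:ℝ) ^ (-(μ.1:ℝ))) *
          ∑' J : (Jmu 𝒥 C k μ.1), ((J : Set ℝ).ncard : ℝ≥0∞)) ≤
      ENNReal.ofReal (C1 * (2:ℝ) ^ (-(n:ℝ))) * (covN (Ek E k) ((2:ℝ) ^ (k - (n:ℤ))) : ℝ≥0∞)

/-- The regularity hypothesis `(R_p)`. -/
def RegHyp (E : Set ℝ) (d : ℕ) (p : ℝ) : Prop :=
  ∃ (𝒥 : ℤ → Set (Set ℝ)) (C : ℝ), RegFamilyCore E d p 𝒥 C ∧ CardCond E 𝒥 C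

/-- The regularity hypothesis `(R̃_{p_d})`. -/
def RegHypTilde (E : Set ℝ) (d : ℕ) (p : ℝ) : Prop :=
  ∃ (𝒥 : ℤ → Set (Set ℝ)) (C : ℝ), RegFamilyCore E d p 𝒥 C ∧ CardCondTilde E 𝒥 C

theorem covN_le_of_finset {S : Set ℝ} {δ : ℝ} (F : Finset ℝ)
    (h : ∀ x ∈ S, ∃ c ∈ F, x ∈ Icc c (c + δ)) : covN S δ ≤ max 1 F.card := by
  refine max_le_max le_rfl (Nat.sInf_le ⟨fun i => (F.equivFin.symm i : ℝ), fun x hx => ?_⟩)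
  obtain ⟨c, hc, hxc⟩ := h x hx
  exact mem_iUnion.2 ⟨F.equivFin ⟨c, hc⟩, by simpa using hxc⟩

theorem exists_grid_cover (a : ℝ) {L δ : ℝ} (hδ : 0 < δ) (hL : 0 ≤ L) :
    ∃ F : Finset ℝ, (F.card : ℝ) ≤ L / δ + 1 ∧
      ∀ x ∈ Icc a (a + L), ∃ c ∈ F, x ∈ Icc c (c + δ) := by
  refine ⟨(Finset.range (⌊L / δ⌋₊ + 1)).image (fun i : ℕ => a + i * δ), ?_, fun x hx => ?_⟩
  · have h1 : (((Finset.range (⌊L / δ⌋₊ + 1)).image (fun i : ℕ => a + i * δ)).card : ℝ)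
        ≤ (⌊L / δ⌋₊ + 1 : ℕ) := by
      exact_mod_cast Finset.card_image_le.trans (Finset.card_range _).le
    have h2 := Nat.floor_le (div_nonneg hL hδ.le)
    push_cast at h1
    linarith
  · have h0 : 0 ≤ (x - a) / δ := div_nonneg (by linarith [hx.1]) hδ.le
    refine ⟨_, Finset.mem_image_of_mem _ (a := ⌊(x - a) / δ⌋₊) ?_, ?_, ?_⟩
    · refine Finset.mem_range.2 (Nat.lt_succ_of_le (Nat.floor_le_floor ?_))
      gcongr
      linarith [hx.2]
    · have := (le_div_iff₀ hδ).1 (Nat.floor_le h0)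
      linarith
    · have := (div_lt_iff₀ hδ).1 (Nat.lt_floor_add_one ((x - a) / δ))
      linarith

theorem exists_cover_of_subset_Icc {S : Set ℝ} {a b δ : ℝ} (hS : S ⊆ Icc a b) (hδ : 0 < δ) :
    ∃ n ≤ covN S δ, ∃ c : Fin n → ℝ, S ⊆ ⋃ i, Icc (c i) (c i + δ) := by
  refine ⟨_, le_max_right _ _, Nat.sInf_mem
    (s := {n : ℕ | ∃ c : Fin n → ℝ, S ⊆ ⋃ i, Icc (c i) (c i + δ)}) ?_⟩
  obtain ⟨F, -, hF⟩ := exists_grid_cover a hδ (le_max_right (b - a) 0)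
  refine ⟨F.card, fun i => (F.equivFin.symm i : ℝ), fun x hx => ?_⟩
  obtain ⟨c, hc, hxc⟩ := hF x ⟨(hS hx).1, by linarith [(hS hx).2, le_max_left (b - a) 0]⟩
  exact mem_iUnion.2 ⟨F.equivFin ⟨c, hc⟩, by simpa using hxc⟩

theorem sum_gap_Ico {s : ℕ → ℝ} {m n : ℕ} (h : m ≤ n) :
    ∑ ν ∈ Finset.Ico m n, (s (ν + 1) - s ν) = s n - s m := by
  rw [Finset.sum_Ico_eq_sub _ h, Finset.sum_range_sub, Finset.sum_range_sub]
  ring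

theorem sum_gap_le_of_abs_sub_le {s : ℕ → ℝ} {δ η : ℝ} (hδ : 0 ≤ δ) (hη : 0 ≤ η)
    (hs : Monotone s) (T : Finset ℕ) (hT : ∀ ν ∈ T, s (ν + 1) - s ν ≤ η)
    (hd : ∀ μ ∈ T, ∀ ν ∈ T, |s μ - s ν| ≤ δ) :
    ∑ ν ∈ T, (s (ν + 1) - s ν) ≤ δ + η := by
  rcases T.eq_empty_or_nonempty with rfl | hne
  · simpa using add_nonneg hδ hη
  have hsub : T ⊆ Finset.Ico (T.min' hne) (T.max' hne + 1) := fun ν hν =>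
    Finset.mem_Ico.2 ⟨T.min'_le ν hν, Nat.lt_succ_of_le (T.le_max' ν hν)⟩
  have h1 := Finset.sum_le_sum_of_subset_of_nonneg (f := fun ν => s (ν + 1) - s ν) hsub
    (fun i _ _ => sub_nonneg.2 (hs i.le_succ))
  rw [sum_gap_Ico ((T.min'_le _ (T.max'_mem hne)).trans (Nat.le_succ _))] at h1
  have h2 := hT _ (T.max'_mem hne)
  have h3 := (abs_le.1 (hd _ (T.max'_mem hne) _ (T.min'_mem hne))).2
  linarith

/-- The gaps of size at most `η` of a bounded monotone sequence have total length at most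
`(δ + η) N(δ)`. -/
theorem sum_gap_le_covN {t s : ℕ → ℝ} {a b δ η : ℝ} (hδ : 0 < δ) (hη : 0 ≤ η)
    (ht : ∀ ν, t ν ∈ Icc a b) (hs : Monotone s)
    (hdist : ∀ μ ν, dist (t μ) (t ν) = |s μ - s ν|)
    (T : Finset ℕ) (hT : ∀ ν ∈ T, s (ν + 1) - s ν ≤ η) :
    ∑ ν ∈ T, (s (ν + 1) - s ν) ≤ (δ + η) * covN (range t) δ := by
  obtain ⟨n, hn, c, hc⟩ := exists_cover_of_subset_Icc (range_subset_iff.2 ht) hδ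
  have hf : ∀ ν, ∃ i, t ν ∈ Icc (c i) (c i + δ) := fun ν => mem_iUnion.1 (hc (mem_range_self ν))
  choose f hf using hf
  rw [← Finset.sum_fiberwise T f]
  have h1 : ∀ i ∈ (Finset.univ : Finset (Fin n)),
      ∑ ν ∈ T with f ν = i, (s (ν + 1) - s ν) ≤ δ + η := by
    intro i _
    refine sum_gap_le_of_abs_sub_le hδ.le hη hs _ (fun ν hν => hT ν (Finset.mem_filter.1 hν).1) ?_
    intro μ hμ ν hν
    have hμ' := hf μ
    have hν' := hf ν
    rw [(Finset.mem_filter.1 hμ).2] at hμ'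
    rw [(Finset.mem_filter.1 hν).2] at hν'
    rw [← hdist, Real.dist_eq, abs_le]
    constructor <;> linarith [hμ'.1, hμ'.2, hν'.1, hν'.2]
  refine (Finset.sum_le_card_nsmul _ _ _ h1).trans ?_
  have : (n : ℝ) ≤ covN (range t) δ := by exact_mod_cast hn
  rw [Finset.card_univ, Fintype.card_fin, nsmul_eq_mul, mul_comm]
  gcongr

/-- The points of the sequence `t` adjacent to the gaps with index in `A`. -/
def gapPoints (t : ℕ → ℝ) (A : Set ℕ) : Set ℝ := t '' (A ∪ (· + 1) '' A)

theorem infDist_gapPoints {t s : ℕ → ℝ} {δ : ℝ} (hδ : 0 < δ) (hs : Monotone s)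
    (hg : Antitone fun ν => s (ν + 1) - s ν)
    (hdist : ∀ μ ν, dist (t μ) (t ν) = |s μ - s ν|) {A : Set ℕ}
    (hA : ∀ ν ∈ A, δ / 2 < s (ν + 1) - s ν ∧ s (ν + 1) - s ν ≤ δ) :
    ∀ x ∈ gapPoints t A, δ / 2 ≤ infDist x (gapPoints t A \ {x}) ∧
      infDist x (gapPoints t A \ {x}) ≤ δ := by
  have sep : ∀ μ ν, μ < ν → ν ∈ A ∪ (· + 1) '' A → δ / 2 ≤ dist (t μ) (t ν) := by
    intro μ ν hμν hν
    obtain ⟨ρ, rfl⟩ : ∃ ρ, ν = ρ + 1 := ⟨ν - 1, by omega⟩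
    have h1 : δ / 2 < s (ρ + 1) - s ρ := by
      rcases hν with hν | ⟨ρ', hρ', h⟩
      · exact (hA _ hν).1.trans_le (hg ρ.le_succ)
      · obtain rfl : ρ' = ρ := by simpa using h
        exact (hA _ hρ').1
    have h2 := hs (Nat.lt_succ_iff.1 hμν)
    rw [hdist, abs_sub_comm]
    exact le_trans (by linarith) (le_abs_self _)
  have neighbour : ∀ x ∈ gapPoints t A, ∃ y ∈ gapPoints t A \ {x}, dist x y ≤ δ := by
    have key : ∀ ν ∈ A, dist (t ν) (t (ν + 1)) ≤ δ ∧ t ν ≠ t (ν + 1) := by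
      intro ν hν
      have h := hA ν hν
      have h' : dist (t ν) (t (ν + 1)) = s (ν + 1) - s ν := by
        rw [hdist, abs_sub_comm, abs_of_nonneg (sub_nonneg.2 (hs ν.le_succ))]
      refine ⟨h'.trans_le h.2, fun he => ?_⟩
      rw [he, dist_self] at h'
      linarith
    rintro _ ⟨ν, hν | ⟨ν, hν, rfl⟩, rfl⟩
    · exact ⟨_, ⟨mem_image_of_mem t (Or.inr (mem_image_of_mem _ hν)), (key ν hν).2.symm⟩,
        (key ν hν).1⟩
    · exact ⟨_, ⟨mem_image_of_mem t (Or.inl hν), (key ν hν).2⟩, by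
        rw [dist_comm]; exact (key ν hν).1⟩
  intro x hx
  obtain ⟨y, hy, hxy⟩ := neighbour x hx
  refine ⟨(le_infDist ⟨y, hy⟩).2 ?_, (infDist_le_dist_of_mem hy).trans hxy⟩
  rintro z ⟨⟨ν, hν, rfl⟩, hzx⟩
  obtain ⟨μ, hμ, rfl⟩ := hx
  rcases lt_trichotomy μ ν with h | rfl | h
  · exact sep _ _ h hν
  · exact absurd rfl hzx
  · rw [dist_comm]
    exact sep _ _ h hμ

theorem antitone_diff_of_bddAbove {s : ℕ → ℝ} {b : ℝ} (hs : Monotone s) (hb : ∀ ν, s ν ≤ b)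
    (h : Monotone (fun ν => s (ν + 1) - s ν) ∨ Antitone (fun ν => s (ν + 1) - s ν)) :
    Antitone (fun ν => s (ν + 1) - s ν) := by
  refine h.elim (fun h => ?_) id
  suffices hz : ∀ ν, s (ν + 1) - s ν = 0 by simpa [hz] using antitone_const
  intro ν
  refine le_antisymm (not_lt.1 fun hpos => ?_) (sub_nonneg.2 (hs ν.le_succ))
  obtain ⟨n, hn⟩ := exists_nat_gt ((b - s ν) / (s (ν + 1) - s ν))
  rw [div_lt_iff₀ hpos] at hn
  have : ∀ n : ℕ, s ν + n * (s (ν + 1) - s ν) ≤ s (ν + n) := by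
    intro n
    induction n with
    | zero => simp
    | succ n ih =>
      have := h (Nat.le_add_right ν n)
      push_cast
      rw [← add_assoc]
      simp only at this
      linarith
  linarith [this n, hb (ν + n)]

/-- The indices of the nonzero gaps of `s` to which `l` assigns the level `m`. -/
def gapLevel (s : ℕ → ℝ) (l : ℕ → ℕ) (m : ℕ) : Set ℕ := {ν | 0 < s (ν + 1) - s ν ∧ l ν = m}

/-- The family of the nonempty sets of points adjacent to the gaps of a given level. -/
def gapFamily (t s : ℕ → ℝ) (l : ℕ → ℕ) : Set (Set ℝ) :=
  {J | ∃ m, (gapLevel s l m).Nonempty ∧ gapPoints t (gapLevel s l m) = J}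

theorem ncard_gapPoints_le (t : ℕ → ℝ) (A : Set ℕ) :
    ((gapPoints t A).ncard : ℝ≥0∞) ≤ 2 * ∑' _ : A, 1 := by
  have h : ((gapPoints t A).ncard : ℕ∞) ≤ 2 * A.encard := by
    refine (ncard_le_encard _).trans ((encard_image_le _ _).trans ((encard_union_le _ _).trans ?_))
    rw [two_mul]
    exact add_le_add le_rfl (encard_image_le _ _)
  rw [ENNReal.tsum_set_one]
  exact_mod_cast ENat.toENNReal_le.2 h

theorem tsum_ofReal_gap_le {t s : ℕ → ℝ} {a b δ η : ℝ} (hδ : 0 < δ) (hη : 0 ≤ η)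
    (ht : ∀ ν, t ν ∈ Icc a b) (hs : Monotone s)
    (hdist : ∀ μ ν, dist (t μ) (t ν) = |s μ - s ν|) :
    ∑' ν, (if s (ν + 1) - s ν ≤ η then ENNReal.ofReal (s (ν + 1) - s ν) else 0) ≤
      ENNReal.ofReal ((δ + η) * covN (range t) δ) := by
  rw [ENNReal.tsum_eq_iSup_sum]
  refine iSup_le fun T => ?_
  rw [← Finset.sum_filter,
    ← ENNReal.ofReal_sum_of_nonneg (fun ν _ => sub_nonneg.2 (hs ν.le_succ))]
  exact ENNReal.ofReal_le_ofReal (sum_gap_le_covN hδ hη ht hs hdist _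
    fun ν hν => (Finset.mem_filter.1 hν).2)

section Family

variable {k : ℤ} {t s : ℕ → ℝ} {l : ℕ → ℕ}

theorem equallySpaced_of_mem_gapFamily (hs : Monotone s)
    (hg : Antitone fun ν => s (ν + 1) - s ν)
    (hdist : ∀ μ ν, dist (t μ) (t ν) = |s μ - s ν|)
    (hl : ∀ ν, 0 < s (ν + 1) - s ν →
      (2 : ℝ) ^ (k - l ν) / 2 < s (ν + 1) - s ν ∧ s (ν + 1) - s ν ≤ (2 : ℝ) ^ (k - l ν)) (m : ℕ) :
    ∀ x ∈ gapPoints t (gapLevel s l m),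
      (2 : ℝ) ^ (k - m) / 2 ≤ infDist x (gapPoints t (gapLevel s l m) \ {x}) ∧
      infDist x (gapPoints t (gapLevel s l m) \ {x}) ≤ (2 : ℝ) ^ (k - m) := by
  refine infDist_gapPoints (by positivity) hs hg hdist ?_
  rintro ν ⟨hν, rfl⟩
  exact hl ν hν

theorem tsum_Jmu_gapFamily_le (hs : Monotone s)
    (hg : Antitone fun ν => s (ν + 1) - s ν)
    (hdist : ∀ μ ν, dist (t μ) (t ν) = |s μ - s ν|)
    (hl : ∀ ν, 0 < s (ν + 1) - s ν →
      (2 : ℝ) ^ (k - l ν) / 2 < s (ν + 1) - s ν ∧ s (ν + 1) - s ν ≤ (2 : ℝ) ^ (k - l ν)) (μ : ℕ) :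
    ∑' J : Jmu (fun _ => gapFamily t s l) 2 k μ, ((J : Set ℝ).ncard : ℝ≥0∞) ≤
      ∑' m, if μ ≤ m + 2 ∧ m ≤ μ + 1 then ((gapPoints t (gapLevel s l m)).ncard : ℝ≥0∞) else 0 := by
  have hJ : ∀ J : Jmu (fun _ => gapFamily t s l) 2 k μ,
      ∃ m, gapPoints t (gapLevel s l m) = J ∧ μ ≤ m + 2 ∧ m ≤ μ + 1 := by
    rintro ⟨_, ⟨m, ⟨ν, hν⟩, rfl⟩, hJ⟩
    have hx : t ν ∈ gapPoints t (gapLevel s l m) := mem_image_of_mem t (Or.inl hν)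
    have h1 := hJ _ hx
    have h2 := equallySpaced_of_mem_gapFamily hs hg hdist hl m _ hx
    have h3 : (2 : ℝ) ^ (k - m - 1) ≤ (2 : ℝ) ^ (k - μ + 1) := by
      rw [zpow_sub_one₀ two_ne_zero, zpow_add_one₀ two_ne_zero]
      linarith [h1.2, h2.1]
    have h4 : (2 : ℝ) ^ (k - μ - 1) ≤ (2 : ℝ) ^ (k - m) := by
      rw [zpow_sub_one₀ two_ne_zero]
      linarith [h1.1, h2.2]
    rw [zpow_le_zpow_iff_right₀ one_lt_two] at h3 h4
    exact ⟨m, rfl, by omega, by omega⟩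
  choose f hf using hJ
  have hinj : Function.Injective f := fun J J' h => Subtype.ext (by rw [← (hf J).1, h, (hf J').1])
  refine le_trans (ENNReal.tsum_le_tsum fun J => ?_) (ENNReal.tsum_comp_le_tsum_of_injective hinj _)
  rw [if_pos (hf J).2, (hf J).1]

theorem tsum_level_weight_le (n m : ℕ) :
    ∑' μ : {μ : ℕ // n ≤ μ}, (if μ.1 ≤ m + 2 ∧ m ≤ μ.1 + 1 then
      ENNReal.ofReal ((2 : ℝ) ^ (-(μ.1 : ℝ))) else 0) ≤
    if n ≤ m + 2 then 8 * ENNReal.ofReal ((2 : ℝ) ^ (-(m : ℝ))) else 0 := by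
  split_ifs with hnm
  · refine (ENNReal.tsum_comp_le_tsum_of_injective Subtype.val_injective (fun μ : ℕ =>
      if μ ≤ m + 2 ∧ m ≤ μ + 1 then ENNReal.ofReal ((2 : ℝ) ^ (-(μ : ℝ))) else 0)).trans ?_
    rw [tsum_eq_sum (s := Finset.Icc (m - 1) (m + 2)) (fun μ hμ => if_neg fun h =>
      hμ (Finset.mem_Icc.2 (by omega)))]
    refine (Finset.sum_le_card_nsmul _ _ (2 * ENNReal.ofReal ((2 : ℝ) ^ (-(m : ℝ)))) ?_).trans ?_
    · intro μ _
      split_ifs with h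
      · have h1 : (2 : ℝ) * 2 ^ (-(m : ℝ)) = 2 ^ (1 + -(m : ℝ)) := by
          rw [Real.rpow_add two_pos, Real.rpow_one]
        rw [← ENNReal.ofReal_ofNat, ← ENNReal.ofReal_mul two_pos.le, h1]
        refine ENNReal.ofReal_le_ofReal (Real.rpow_le_rpow_of_exponent_le one_le_two ?_)
        have : (m : ℝ) ≤ μ + 1 := by exact_mod_cast h.2
        linarith
      · exact zero_le
    · rw [nsmul_eq_mul, ← mul_assoc]
      gcongr
      have : (Finset.Icc (m - 1) (m + 2)).card ≤ 4 := by rw [Nat.card_Icc]; omega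
      calc ((Finset.Icc (m - 1) (m + 2)).card : ℝ≥0∞) * 2 ≤ (4 : ℕ) * 2 := by gcongr
        _ = 8 := by norm_num
  · refine (ENNReal.tsum_eq_zero.2 fun μ => if_neg fun h => hnm (μ.2.trans h.1)).le

theorem ofReal_mul_ncard_gapPoints_le
    (hl : ∀ ν, 0 < s (ν + 1) - s ν →
      (2 : ℝ) ^ (k - l ν) / 2 < s (ν + 1) - s ν ∧ s (ν + 1) - s ν ≤ (2 : ℝ) ^ (k - l ν)) (m : ℕ) :
    ENNReal.ofReal ((2 : ℝ) ^ (-(m : ℝ))) * ((gapPoints t (gapLevel s l m)).ncard : ℝ≥0∞) ≤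
      ∑' ν, (gapLevel s l m).indicator
        (fun ν => ENNReal.ofReal (4 / 2 ^ k) * ENNReal.ofReal (s (ν + 1) - s ν)) ν := by
  rw [← tsum_subtype]
  calc _ ≤ ENNReal.ofReal ((2 : ℝ) ^ (-(m : ℝ))) * (2 * ∑' _ : gapLevel s l m, 1) := by
        gcongr; exact ncard_gapPoints_le _ _
    _ = ∑' _ : gapLevel s l m, ENNReal.ofReal ((2 : ℝ) ^ (-(m : ℝ))) * 2 := by
        rw [← mul_assoc, ← ENNReal.tsum_mul_left]; simp
    _ ≤ _ := by
        refine ENNReal.tsum_le_tsum ?_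
        rintro ⟨ν, hν, rfl⟩
        rw [← ENNReal.ofReal_ofNat, ← ENNReal.ofReal_mul (by positivity),
          ← ENNReal.ofReal_mul (by positivity)]
        refine ENNReal.ofReal_le_ofReal ?_
        have h := (hl ν hν).1
        rw [zpow_sub₀ two_ne_zero, zpow_natCast] at h
        rw [Real.rpow_neg two_pos.le, Real.rpow_natCast, div_mul_eq_mul_div,
          le_div_iff₀ (by positivity)]
        have : ((2 : ℝ) ^ l ν)⁻¹ * 2 * 2 ^ k = 4 * (2 ^ k / 2 ^ l ν / 2) := by ring
        linarith

theorem tsum_tsum_Jmu_gapFamily_le {a b : ℝ} (ht : ∀ ν, t ν ∈ Icc a b) (hs : Monotone s)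
    (hg : Antitone fun ν => s (ν + 1) - s ν)
    (hdist : ∀ μ ν, dist (t μ) (t ν) = |s μ - s ν|)
    (hl : ∀ ν, 0 < s (ν + 1) - s ν →
      (2 : ℝ) ^ (k - l ν) / 2 < s (ν + 1) - s ν ∧ s (ν + 1) - s ν ≤ (2 : ℝ) ^ (k - l ν)) (n : ℕ) :
    (∑' μ : {μ : ℕ // n ≤ μ}, ENNReal.ofReal ((2 : ℝ) ^ (-(μ.1 : ℝ))) *
      ∑' J : Jmu (fun _ => gapFamily t s l) 2 k μ.1, ((J : Set ℝ).ncard : ℝ≥0∞)) ≤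
    ENNReal.ofReal (160 * (2 : ℝ) ^ (-(n : ℝ))) * (covN (range t) ((2 : ℝ) ^ (k - (n : ℤ)))) := by
  set c : ℕ → ℝ≥0∞ := fun m => ((gapPoints t (gapLevel s l m)).ncard : ℝ≥0∞) with hc
  set w : ℕ → ℝ≥0∞ := fun m => ENNReal.ofReal ((2 : ℝ) ^ (-(m : ℝ))) with hw
  set G : ℕ → ℝ≥0∞ := fun ν => ENNReal.ofReal (s (ν + 1) - s ν) with hG
  set δ : ℝ := (2 : ℝ) ^ (k - (n : ℤ)) with hδ
  have hδ0 : 0 < δ := by positivity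
  have hδ' : δ = 2 ^ k * 2 ^ (-(n : ℝ)) := by
    rw [hδ, zpow_sub₀ two_ne_zero, zpow_natCast, Real.rpow_neg two_pos.le, Real.rpow_natCast,
      div_eq_mul_inv]
  calc _ ≤ ∑' μ : {μ : ℕ // n ≤ μ}, w μ * ∑' m, (if μ.1 ≤ m + 2 ∧ m ≤ μ.1 + 1 then c m else 0) :=
        ENNReal.tsum_le_tsum fun μ => by gcongr; exact tsum_Jmu_gapFamily_le hs hg hdist hl _
    _ = ∑' m, (∑' μ : {μ : ℕ // n ≤ μ}, (if μ.1 ≤ m + 2 ∧ m ≤ μ.1 + 1 then w μ else 0)) * c m := by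
        simp_rw [← ENNReal.tsum_mul_left, ← ENNReal.tsum_mul_right]
        rw [ENNReal.tsum_comm]
        simp only [mul_ite, ite_mul, mul_zero, zero_mul]
    _ ≤ ∑' m, (if n ≤ m + 2 then 8 * w m else 0) * c m :=
        ENNReal.tsum_le_tsum fun m => by gcongr; exact tsum_level_weight_le n m
    _ ≤ ∑' m, ∑' ν, (if n ≤ m + 2 then
          8 * (gapLevel s l m).indicator (fun ν => ENNReal.ofReal (4 / 2 ^ k) * G ν) ν else 0) := by
        refine ENNReal.tsum_le_tsum fun m => ?_
        split_ifs
        · rw [ENNReal.tsum_mul_left, mul_assoc]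
          gcongr
          exact ofReal_mul_ncard_gapPoints_le hl m
        · simp
    _ ≤ ∑' ν, 8 * ENNReal.ofReal (4 / 2 ^ k) * (if s (ν + 1) - s ν ≤ 4 * δ then G ν else 0) := by
        rw [ENNReal.tsum_comm]
        refine ENNReal.tsum_le_tsum fun ν => ?_
        rw [tsum_eq_single (l ν)]
        · by_cases h : n ≤ l ν + 2 ∧ ν ∈ gapLevel s l (l ν)
          · rw [if_pos h.1, indicator_of_mem h.2, if_pos, mul_assoc]
            refine (hl ν h.2.1).2.trans ?_
            have : (2 : ℝ) ^ (k - l ν) ≤ 2 ^ (2 + (k - n)) :=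
              zpow_le_zpow_right₀ one_le_two (by omega)
            refine this.trans_eq ?_
            rw [zpow_add₀ two_ne_zero, hδ]
            norm_num
          · rw [not_and_or] at h
            rcases h with h | h
            · rw [if_neg h]; exact zero_le
            · rw [indicator_of_notMem h]; simp
        · intro m hm
          rw [indicator_of_notMem (fun h => hm h.2.symm)]
          simp
    _ ≤ 8 * ENNReal.ofReal (4 / 2 ^ k) * ENNReal.ofReal ((δ + 4 * δ) * covN (range t) δ) := by
        rw [ENNReal.tsum_mul_left]
        gcongr
        exact tsum_ofReal_gap_le hδ0 (by positivity) ht hs hdist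
    _ = _ := by
        rw [← ENNReal.ofReal_natCast, ← ENNReal.ofReal_ofNat, ← ENNReal.ofReal_mul (by positivity),
          ← ENNReal.ofReal_mul (by positivity), ← ENNReal.ofReal_mul (by positivity), hδ']
        congr 1
        field_simp
        ring

theorem covN_endpoints_gapFamily_le {a b δ : ℝ} (hδ : 0 < δ) (ht : ∀ ν, t ν ∈ Icc a b)
    (hs : Monotone s) (hg : Antitone fun ν => s (ν + 1) - s ν)
    (hdist : ∀ μ ν, dist (t μ) (t ν) = |s μ - s ν|)
    (hl : ∀ ν, 0 < s (ν + 1) - s ν →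
      (2 : ℝ) ^ (k - l ν) / 2 < s (ν + 1) - s ν ∧ s (ν + 1) - s ν ≤ (2 : ℝ) ^ (k - l ν)) (M : ℕ) :
    (covN (⋃ J ∈ gapFamily t s l, {sInf J, sSup J}) δ : ℝ) ≤
      2 * M + 4 * 2 ^ (k - M) * covN (range t) (2 ^ (k - M)) / δ + 1 := by
  set η : ℝ := 2 ^ (k - M) with hη
  have hη0 : 0 < η := by positivity
  set L : ℝ := 2 * η * covN (range t) η with hL
  have hL0 : 0 ≤ L := by positivity
  obtain ⟨x, hx⟩ : ∃ x, ∀ m, M ≤ m → gapPoints t (gapLevel s l m) ⊆ Icc (x - L) (x - L + 2 * L) := by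
    by_cases h : ∃ ν, s (ν + 1) - s ν ≤ η
    · obtain ⟨ν₀, hν₀, hmin⟩ : ∃ ν₀, s (ν₀ + 1) - s ν₀ ≤ η ∧ ∀ ν, s (ν + 1) - s ν ≤ η → ν₀ ≤ ν := by
        classical exact ⟨Nat.find h, Nat.find_spec h, fun ν hν => Nat.find_min' h hν⟩
      have tail : ∀ ν, ν₀ ≤ ν → t ν ∈ Icc (t ν₀ - L) (t ν₀ - L + 2 * L) := by
        intro ν hν
        have h1 := sum_gap_le_covN hη0 hη0.le ht hs hdist (Finset.Ico ν₀ ν)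
          (fun i hi => (hg (Finset.mem_Ico.1 hi).1).trans hν₀)
        rw [sum_gap_Ico hν] at h1
        have h2 := hdist ν ν₀
        rw [abs_of_nonneg (sub_nonneg.2 (hs hν)), Real.dist_eq] at h2
        have h3 := abs_le.1 (h2.trans_le h1)
        constructor <;> linarith [h3.1, h3.2]
      refine ⟨t ν₀, fun m hm => ?_⟩
      have small : ∀ ν ∈ gapLevel s l m, ν₀ ≤ ν := by
        rintro ν ⟨hν, rfl⟩
        exact hmin ν ((hl ν hν).2.trans (zpow_le_zpow_right₀ one_le_two (by omega)))
      rintro _ ⟨ν, hν | ⟨ν, hν, rfl⟩, rfl⟩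
      · exact tail _ (small _ hν)
      · exact tail _ ((small _ hν).trans ν.le_succ)
    · refine ⟨0, fun m hm => ?_⟩
      have empty : ∀ ν, ν ∉ gapLevel s l m := by
        rintro ν ⟨hν, rfl⟩
        exact h ⟨ν, (hl ν hν).2.trans (zpow_le_zpow_right₀ one_le_two (by omega))⟩
      rintro _ ⟨ν, hν | ⟨ν, hν, rfl⟩, rfl⟩ <;> exact absurd hν (empty ν)
  obtain ⟨F, hF, hFc⟩ := exists_grid_cover (x - L) (L := 2 * L) hδ (by positivity)
  let P : ℕ → Set ℝ := fun m => gapPoints t (gapLevel s l m)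
  let F' := F ∪ ((Finset.range M).image (fun m => sInf (P m)) ∪
    (Finset.range M).image (fun m => sSup (P m)))
  have hcard : (F'.card : ℝ) ≤ F.card + (M + M) := by
    have h1 : F'.card ≤ F.card + (M + M) := by
      refine (Finset.card_union_le _ _).trans (add_le_add_right
        ((Finset.card_union_le _ _).trans (add_le_add ?_ ?_)) _) <;>
      exact Finset.card_image_le.trans (Finset.card_range _).le
    exact_mod_cast h1
  have hcov := covN_le_of_finset (S := ⋃ J ∈ gapFamily t s l, {sInf J, sSup J}) (δ := δ) F' (by
    intro y hy
    simp only [mem_iUnion] at hy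
    obtain ⟨_, ⟨m, ⟨ν, hν⟩, rfl⟩, hy⟩ := hy
    rcases lt_or_ge m M with hm | hm
    · refine ⟨y, ?_, left_mem_Icc.2 (by linarith)⟩
      rcases hy with rfl | rfl
      · exact Finset.mem_union_right _ (Finset.mem_union_left _
          (Finset.mem_image_of_mem (fun m => sInf (P m)) (Finset.mem_range.2 hm)))
      · exact Finset.mem_union_right _ (Finset.mem_union_right _
          (Finset.mem_image_of_mem (fun m => sSup (P m)) (Finset.mem_range.2 hm)))
    · have hne : (P m).Nonempty := ⟨_, mem_image_of_mem t (Or.inl hν)⟩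
      have hcl : closure (P m) ⊆ Icc (x - L) (x - L + 2 * L) := closure_minimal (hx m hm) isClosed_Icc
      have hy' : y ∈ Icc (x - L) (x - L + 2 * L) := by
        rcases hy with rfl | rfl
        · exact hcl (csInf_mem_closure hne (bddBelow_Icc.mono (hx m hm)))
        · exact hcl (csSup_mem_closure hne (bddAbove_Icc.mono (hx m hm)))
      obtain ⟨c, hc, hyc⟩ := hFc y hy'
      exact ⟨c, Finset.mem_union_left _ hc, hyc⟩)
  have hcov' : (covN (⋃ J ∈ gapFamily t s l, {sInf J, sSup J}) δ : ℝ) ≤ max 1 (F'.card : ℝ) := by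
    exact_mod_cast hcov
  refine hcov'.trans (max_le ?_ ?_)
  · have : 0 ≤ 4 * η * covN (range t) η / δ := by positivity
    linarith [(Nat.cast_nonneg M : (0 : ℝ) ≤ M)]
  · have : 2 * L / δ = 4 * η * covN (range t) η / δ := by rw [hL]; ring
    linarith

end Family

theorem exists_zpow_level {k : ℤ} {g : ℕ → ℝ} (hg : ∀ ν, g ν ≤ (2 : ℝ) ^ k) :
    ∃ l : ℕ → ℕ, ∀ ν, 0 < g ν → (2 : ℝ) ^ (k - l ν) / 2 < g ν ∧ g ν ≤ (2 : ℝ) ^ (k - l ν) := by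
  have h : ∀ ν, ∃ m : ℕ, 0 < g ν → (2 : ℝ) ^ (k - m) / 2 < g ν ∧ g ν ≤ (2 : ℝ) ^ (k - m) := by
    intro ν
    by_cases hν : 0 < g ν
    · have hk : (0 : ℝ) < 2 ^ k := by positivity
      obtain ⟨m, h1, h2⟩ := exists_nat_pow_near_of_lt_one (div_pos hν hk)
        ((div_le_one hk).2 (hg ν)) (y := (1 / 2 : ℝ)) (by norm_num) (by norm_num)
      refine ⟨m, fun _ => ?_⟩
      have h3 : (2 : ℝ) ^ (k - m) = (1 / 2) ^ m * 2 ^ k := by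
        rw [zpow_sub₀ two_ne_zero, zpow_natCast, one_div, inv_pow]
        ring
      rw [lt_div_iff₀ hk, pow_succ] at h1
      rw [div_le_iff₀ hk] at h2
      rw [h3]
      exact ⟨by linarith, h2⟩
    · exact ⟨0, fun h => absurd h hν⟩
  choose l hl using h
  exact ⟨l, hl⟩

theorem range_subset_biUnion_gapFamily {t s : ℕ → ℝ} {l : ℕ → ℕ} (hs : Monotone s)
    (hg : Antitone fun ν => s (ν + 1) - s ν)
    (hdist : ∀ μ ν, dist (t μ) (t ν) = |s μ - s ν|)
    (hpos : ∃ ν, 0 < s (ν + 1) - s ν) : range t ⊆ ⋃ J ∈ gapFamily t s l, J := by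
  have hmem : ∀ ν, 0 < s (ν + 1) - s ν → t ν ∈ (⋃ J ∈ gapFamily t s l, J) ∧
      t (ν + 1) ∈ ⋃ J ∈ gapFamily t s l, J := by
    intro ν hν
    have hν' : ν ∈ gapLevel s l (l ν) := ⟨hν, rfl⟩
    exact ⟨mem_biUnion ⟨l ν, ⟨ν, hν'⟩, rfl⟩ (mem_image_of_mem t (Or.inl hν')),
      mem_biUnion ⟨l ν, ⟨ν, hν'⟩, rfl⟩ (mem_image_of_mem t (Or.inr (mem_image_of_mem _ hν')))⟩
  rintro _ ⟨ν, rfl⟩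
  induction ν with
  | zero =>
    obtain ⟨ν, hν⟩ := hpos
    exact (hmem 0 (hν.trans_le (hg ν.zero_le))).1
  | succ ν ih =>
    by_cases hν : 0 < s (ν + 1) - s ν
    · exact (hmem ν hν).2
    · have h0 : s (ν + 1) - s ν = 0 := le_antisymm (not_lt.1 hν) (sub_nonneg.2 (hs ν.le_succ))
      have : t (ν + 1) = t ν := by rw [← dist_eq_zero, hdist, h0, abs_zero]
      rwa [this]

/-- The conclusions of the regularity hypotheses `(R_p)`, `(R̃_p)` at a single dyadic scale, for
a family `F` covering `S`, where the endpoints obey a power bound with exponent `γ`. -/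
structure IsRegularFamily (k : ℤ) (S : Set ℝ) (B γ : ℝ) (F : Set (Set ℝ)) : Prop where
  subset_Icc : ∀ J ∈ F, J ⊆ Icc ((2 : ℝ) ^ k) ((2 : ℝ) ^ (k + 1))
  cover : S ⊆ ⋃ J ∈ F, J
  equallySpaced : ∀ J ∈ F, ∃ δ : ℝ, 0 < δ ∧ EquallySpaced J δ 2
  covN_endpoints_le : ∀ j : ℕ, (covN (⋃ J ∈ F, {sInf J, sSup J}) (2 ^ (k - (j : ℤ))) : ℝ) ≤
    B * 2 ^ ((j : ℝ) * γ)
  tsum_card_le : ∀ n : ℕ, (∑' μ : {μ : ℕ // n ≤ μ}, ENNReal.ofReal ((2 : ℝ) ^ (-(μ.1 : ℝ))) *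
      ∑' J : Jmu (fun _ => F) 2 k μ.1, ((J : Set ℝ).ncard : ℝ≥0∞)) ≤
    ENNReal.ofReal (160 * (2 : ℝ) ^ (-(n : ℝ))) * (covN S ((2 : ℝ) ^ (k - (n : ℤ))))

theorem tsum_two_rpow_neg_le (n : ℕ) :
    ∑' μ : {μ : ℕ // n ≤ μ}, ENNReal.ofReal ((2 : ℝ) ^ (-(μ.1 : ℝ))) ≤
      2 * ENNReal.ofReal ((2 : ℝ) ^ (-(n : ℝ))) := by
  have hinj : Function.Injective fun μ : {μ : ℕ // n ≤ μ} => μ.1 - n := by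
    rintro ⟨μ, hμ⟩ ⟨μ', hμ'⟩ h
    simp only at h
    exact Subtype.ext (by simp only; omega)
  calc _ = ∑' μ : {μ : ℕ // n ≤ μ}, ENNReal.ofReal ((2 : ℝ) ^ (-(n : ℝ))) * 2⁻¹ ^ (μ.1 - n) := by
        congr 1 with ⟨μ, hμ⟩
        obtain ⟨i, rfl⟩ := Nat.exists_eq_add_of_le hμ
        have h1 : (2⁻¹ : ℝ≥0∞) = ENNReal.ofReal 2⁻¹ := by
          rw [ENNReal.ofReal_inv_of_pos two_pos, ENNReal.ofReal_ofNat]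
        rw [h1, ← ENNReal.ofReal_pow (by norm_num), ← ENNReal.ofReal_mul (by positivity)]
        congr 1
        simp [Real.rpow_neg, mul_comm, Real.rpow_add]
    _ ≤ ENNReal.ofReal ((2 : ℝ) ^ (-(n : ℝ))) * 2 := by
        rw [ENNReal.tsum_mul_left]
        gcongr
        refine (ENNReal.tsum_comp_le_tsum_of_injective hinj (fun i => (2⁻¹ : ℝ≥0∞) ^ i)).trans ?_
        rw [ENNReal.tsum_geometric, ENNReal.one_sub_inv_two, inv_inv]
    _ = _ := mul_comm _ _

theorem isRegularFamily_pair {k : ℤ} {x B γ : ℝ} (hx : x ∈ Ico ((2 : ℝ) ^ k) (2 ^ (k + 1)))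
    (hB : 2 ≤ B) (hγ : 0 ≤ γ) : ∃ F, IsRegularFamily k {x} B γ F := by
  have hk : (0 : ℝ) < 2 ^ k := by positivity
  rw [zpow_add_one₀ two_ne_zero] at hx
  obtain ⟨y, hy, hxy⟩ : ∃ y ∈ Icc ((2 : ℝ) ^ k) (2 ^ (k + 1)), dist x y = 2 ^ k / 2 := by
    rw [zpow_add_one₀ two_ne_zero]
    rcases le_total x (3 / 2 * 2 ^ k) with h | h
    · exact ⟨x + 2 ^ k / 2, ⟨by linarith [hx.1], by linarith⟩, by
        rw [Real.dist_eq, abs_sub_comm, add_sub_cancel_left, abs_of_pos (by positivity)]⟩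
    · exact ⟨x - 2 ^ k / 2, ⟨by linarith, by linarith [hx.2]⟩, by
        rw [Real.dist_eq, sub_sub_cancel, abs_of_pos (by positivity)]⟩
  have hne : x ≠ y := fun h => by
    rw [h, dist_self] at hxy
    linarith
  refine ⟨{{x, y}}, ⟨?_, ?_, ?_, fun j => ?_, fun n => ?_⟩⟩
  · rintro _ rfl
    rw [zpow_add_one₀ two_ne_zero] at hy ⊢
    exact insert_subset ⟨hx.1, hx.2.le⟩ (singleton_subset_iff.2 hy)
  · simp
  · rintro _ rfl
    refine ⟨2 ^ k / 2, by positivity, ?_⟩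
    rintro z (rfl | rfl)
    · rw [pair_sdiff_left hne, infDist_singleton, hxy]
      constructor <;> linarith
    · rw [pair_sdiff_right hne, infDist_singleton, dist_comm, hxy]
      constructor <;> linarith
  · have h1 := covN_le_of_finset (S := ⋃ J ∈ ({{x, y}} : Set (Set ℝ)), {sInf J, sSup J})
      (δ := 2 ^ (k - (j : ℤ))) {sInf {x, y}, sSup {x, y}} (fun z hz =>
        ⟨z, by simpa using hz, left_mem_Icc.2 (le_add_of_nonneg_right (by positivity))⟩)
    have h2 : (covN (⋃ J ∈ ({{x, y}} : Set (Set ℝ)), {sInf J, sSup J}) (2 ^ (k - (j : ℤ))) : ℝ)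
        ≤ 2 := by
      exact_mod_cast h1.trans (max_le one_le_two Finset.card_le_two)
    have h3 : (1 : ℝ) ≤ 2 ^ ((j : ℝ) * γ) := Real.one_le_rpow one_le_two (by positivity)
    nlinarith
  · have hJ : ∀ μ : ℕ, ∑' J : Jmu (fun _ => {{x, y}}) 2 k μ, ((J : Set ℝ).ncard : ℝ≥0∞) ≤ 2 := by
      intro μ
      refine (ENNReal.tsum_mono_subtype (fun J : Set ℝ => (J.ncard : ℝ≥0∞))
        (t := {{x, y}}) (fun J hJ => hJ.1)).trans ?_
      rw [tsum_singleton ({x, y} : Set ℝ) (fun J : Set ℝ => (J.ncard : ℝ≥0∞)), ncard_pair hne]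
      norm_num
    calc _ ≤ ∑' μ : {μ : ℕ // n ≤ μ}, ENNReal.ofReal ((2 : ℝ) ^ (-(μ.1 : ℝ))) * 2 :=
          ENNReal.tsum_le_tsum fun μ => by gcongr; exact hJ _
      _ ≤ 2 * ENNReal.ofReal ((2 : ℝ) ^ (-(n : ℝ))) * 2 := by
          rw [ENNReal.tsum_mul_right]
          gcongr
          exact tsum_two_rpow_neg_le n
      _ ≤ ENNReal.ofReal (160 * (2 : ℝ) ^ (-(n : ℝ))) * 1 := by
          rw [mul_one, mul_right_comm, ENNReal.ofReal_mul (by norm_num)]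
          gcongr
          rw [ENNReal.ofReal_ofNat]
          norm_num
      _ ≤ _ := by
          gcongr
          exact_mod_cast le_max_left 1 _

theorem isRegularFamily_gapFamily {k : ℤ} {t s : ℕ → ℝ} {l : ℕ → ℕ} {β C : ℝ} (hβ : 0 < β)
    (ht : ∀ ν, t ν ∈ Icc ((2 : ℝ) ^ k) (2 ^ (k + 1))) (hs : Monotone s)
    (hg : Antitone fun ν => s (ν + 1) - s ν)
    (hdist : ∀ μ ν, dist (t μ) (t ν) = |s μ - s ν|) (hpos : ∃ ν, 0 < s (ν + 1) - s ν)
    (hl : ∀ ν, 0 < s (ν + 1) - s ν →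
      (2 : ℝ) ^ (k - l ν) / 2 < s (ν + 1) - s ν ∧ s (ν + 1) - s ν ≤ (2 : ℝ) ^ (k - l ν))
    (hC : 0 ≤ C) (hN : ∀ n : ℕ,
      (covN (range t) ((2 : ℝ) ^ (k - (n : ℤ))) : ℝ) ≤ C * 2 ^ (n : ℝ) * (1 + (n : ℝ)) ^ (-β)) :
    IsRegularFamily k (range t) (5 + 4 * C) (1 / (β + 1)) (gapFamily t s l) where
  subset_Icc := by
    rintro _ ⟨m, -, rfl⟩
    rintro _ ⟨ν, -, rfl⟩
    exact ht ν
  cover := range_subset_biUnion_gapFamily hs hg hdist hpos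
  equallySpaced := by
    rintro _ ⟨m, -, rfl⟩
    refine ⟨2 ^ (k - m), by positivity, fun x hx => ?_⟩
    have h := equallySpaced_of_mem_gapFamily hs hg hdist hl m x hx
    have : (0 : ℝ) < 2 ^ (k - m) := by positivity
    constructor <;> linarith [h.1, h.2]
  covN_endpoints_le := fun j => by
    set X : ℝ := 2 ^ ((j : ℝ) * (1 / (β + 1))) with hX
    have hX1 : 1 ≤ X := Real.one_le_rpow one_le_two (by positivity)
    have hXj : (2 : ℝ) ^ j * X ^ (-β) = X := by
      rw [hX, ← Real.rpow_mul two_pos.le, ← Real.rpow_natCast, ← Real.rpow_add two_pos]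
      congr 1
      field_simp
      ring
    have hM := Nat.ceil_lt_add_one (zero_le_one.trans hX1)
    have hM' := Nat.le_ceil X
    set M := ⌈X⌉₊ with hM_def
    have h1 := covN_endpoints_gapFamily_le (δ := 2 ^ (k - (j : ℤ))) (by positivity) ht hs hg
      hdist hl M
    have h2 : 4 * 2 ^ (k - (M : ℤ)) * (covN (range t) (2 ^ (k - (M : ℤ))) : ℝ) / 2 ^ (k - (j : ℤ))
        ≤ 4 * C * X := by
      calc _ ≤ 4 * 2 ^ (k - (M : ℤ)) * (C * 2 ^ (M : ℝ) * (1 + (M : ℝ)) ^ (-β)) /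
            2 ^ (k - (j : ℤ)) := by gcongr; exact hN M
        _ = 4 * C * (2 ^ j * (1 + (M : ℝ)) ^ (-β)) := by
          rw [zpow_sub₀ two_ne_zero, zpow_sub₀ two_ne_zero, zpow_natCast, zpow_natCast,
            Real.rpow_natCast]
          field_simp
        _ ≤ 4 * C * (2 ^ j * X ^ (-β)) := by
          gcongr 4 * C * (2 ^ j * ?_)
          exact Real.rpow_le_rpow_of_nonpos (by linarith) (by linarith) (by linarith)
        _ = 4 * C * X := by rw [hXj]
    linarith
  tsum_card_le := tsum_tsum_Jmu_gapFamily_le ht hs hg hdist hl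

theorem exists_isRegularFamily {k : ℤ} {t : ℕ → ℝ} {β C : ℝ} (hβ : 0 < β)
    (hmono : Monotone t ∨ Antitone t)
    (hconv : Monotone (fun ν => t (ν + 1) - t ν) ∨ Antitone (fun ν => t (ν + 1) - t ν))
    (ht : ∀ ν, t ν ∈ Icc ((2 : ℝ) ^ k) (2 ^ (k + 1)))
    (h0 : t 0 ∈ Ico ((2 : ℝ) ^ k) (2 ^ (k + 1))) (hC : 0 ≤ C) (hN : ∀ n : ℕ,
      (covN (range t) ((2 : ℝ) ^ (k - (n : ℤ))) : ℝ) ≤ C * 2 ^ (n : ℝ) * (1 + (n : ℝ)) ^ (-β)) :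
    ∃ F, IsRegularFamily k (range t) (5 + 4 * C) (1 / (β + 1)) F := by
  obtain ⟨s, hs, hg, hdist⟩ : ∃ s : ℕ → ℝ, Monotone s ∧ Antitone (fun ν => s (ν + 1) - s ν) ∧
      ∀ μ ν, dist (t μ) (t ν) = |s μ - s ν| := by
    rcases hmono with h | h
    · exact ⟨t, h, antitone_diff_of_bddAbove h (fun ν => (ht ν).2) hconv,
        fun μ ν => Real.dist_eq _ _⟩
    · have hneg : (fun ν => -t (ν + 1) - -t ν) = -(fun ν => t (ν + 1) - t ν) := by
        ext ν
        simp only [Pi.neg_apply]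
        ring
      refine ⟨-t, h.neg, antitone_diff_of_bddAbove h.neg (b := -2 ^ k)
        (fun ν => neg_le_neg (ht ν).1) ?_, fun μ ν => ?_⟩
      · simp only [Pi.neg_apply, hneg]
        exact hconv.symm.imp Antitone.neg Monotone.neg
      · rw [dist_comm, Real.dist_eq, Pi.neg_apply, Pi.neg_apply]
        congr 1
        ring
  by_cases hpos : ∃ ν, 0 < s (ν + 1) - s ν
  · obtain ⟨l, hl⟩ := exists_zpow_level (k := k) (g := fun ν => s (ν + 1) - s ν) (fun ν => by
      refine (le_abs_self _).trans ?_
      rw [← hdist, Real.dist_eq, abs_le]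
      have h1 := ht ν
      have h2 := ht (ν + 1)
      rw [zpow_add_one₀ two_ne_zero] at h1 h2
      constructor <;> linarith [h1.1, h1.2, h2.1, h2.2])
    exact ⟨_, isRegularFamily_gapFamily hβ ht hs hg hdist hpos hl hC hN⟩
  · push Not at hpos
    have hconst : ∀ ν, t ν = t 0 := by
      intro ν
      induction ν with
      | zero => rfl
      | succ ν ih =>
        rw [← ih, ← dist_eq_zero, hdist, abs_eq_zero]
        exact le_antisymm (hpos ν) (sub_nonneg.2 (hs ν.le_succ))
    have : range t = {t 0} := by
      rw [show t = fun _ => t 0 from funext hconst, range_const]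
    rw [this]
    exact isRegularFamily_pair h0 (by linarith) (by positivity)

theorem regFamilyCore_of_isRegularFamily {d : ℕ} {E : Set ℝ} {p B γ : ℝ} (hp : 1 < p) (hB : 0 ≤ B)
    (hγ : γ < ((d : ℝ) - 1) * (p - 1)) {𝒥 : ℤ → Set (Set ℝ)}
    (h𝒥 : ∀ k, IsRegularFamily k (Ek E k) B γ (𝒥 k)) : RegFamilyCore E d p 𝒥 2 := by
  refine ⟨one_lt_two, fun k => (h𝒥 k).subset_Icc, fun k => (h𝒥 k).cover,
    fun k => (h𝒥 k).equallySpaced, ?_⟩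
  have hp1 : 0 < p - 1 := sub_pos.2 hp
  set D : ℝ := ((d : ℝ) - 1) * (p - 1) - γ with hD
  have hD0 : 0 < D := sub_pos.2 hγ
  set r : ℝ := 2 ^ (-(D / (2 * (p - 1)))) with hr
  have hr0 : 0 < r := by positivity
  have hr1 : r < 1 := Real.rpow_lt_one_of_one_lt_of_neg one_lt_two (by
    rw [neg_lt_zero]; positivity)
  set q : ℝ := 2 ^ (-(D / 2)) with hq
  have hq0 : 0 < q := by positivity
  have hq1 : q < 1 := Real.rpow_lt_one_of_one_lt_of_neg one_lt_two (by linarith)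
  have hr1' : 0 < 1 - r := sub_pos.2 hr1
  set ω : ℕ → ℝ := fun j => ((1 - r) * r ^ j) ^ (-((p - 1) / p)) with hω
  refine ⟨ω, fun j => by positivity, ?_, (1 - r) ^ (-(p - 1)) * B * (1 - q)⁻¹, fun k => ?_⟩
  · have h1 : ∀ j, ω j ^ (-(p / (p - 1))) = (1 - r) * r ^ j := by
      intro j
      rw [hω]
      simp only
      rw [← Real.rpow_mul (by positivity)]
      convert Real.rpow_one _ using 2
      field_simp
    simp_rw [h1]
    rw [← ENNReal.ofReal_tsum_of_nonneg (fun j => by positivity)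
      ((summable_geometric_of_lt_one hr0.le hr1).mul_left _), tsum_mul_left,
      tsum_geometric_of_lt_one hr0.le hr1, mul_inv_cancel₀ hr1'.ne', ENNReal.ofReal_one]
  · have h2 : ∀ j : ℕ, ω j ^ p * (B * 2 ^ ((j : ℝ) * γ)) * 2 ^ (-(j : ℝ) * ((d : ℝ) - 1) * (p - 1)) =
        (1 - r) ^ (-(p - 1)) * B * q ^ j := by
      intro j
      have h3 : ω j ^ p = (1 - r) ^ (-(p - 1)) * 2 ^ ((j : ℝ) * (D / 2)) := by
        rw [hω]
        simp only
        rw [← Real.rpow_mul (by positivity), Real.mul_rpow hr1'.le (by positivity), hr,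
          ← Real.rpow_natCast, ← Real.rpow_mul two_pos.le, ← Real.rpow_mul two_pos.le]
        congr 2 <;> field_simp
      rw [h3, hq, ← Real.rpow_natCast, ← Real.rpow_mul two_pos.le]
      have h4 : (2 : ℝ) ^ (-(D / 2) * (j : ℝ)) = 2 ^ ((j : ℝ) * (D / 2)) * 2 ^ ((j : ℝ) * γ) *
          2 ^ (-(j : ℝ) * ((d : ℝ) - 1) * (p - 1)) := by
        rw [← Real.rpow_add two_pos, ← Real.rpow_add two_pos, hD]
        congr 1
        ring
      rw [h4]
      ring
    calc _ ≤ ∑' j : ℕ, ENNReal.ofReal ((1 - r) ^ (-(p - 1)) * B * q ^ j) := by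
          refine ENNReal.tsum_le_tsum fun j => ?_
          have h5 := (h𝒥 (k + j)).covN_endpoints_le j
          rw [add_sub_cancel_right] at h5
          rw [← h2, ENNReal.ofReal_mul (by positivity), ENNReal.ofReal_mul (by positivity),
            ← ENNReal.ofReal_natCast (covN _ _)]
          gcongr
          exact h5
      _ ≤ _ := by
          rw [← ENNReal.ofReal_tsum_of_nonneg (fun j => by positivity)
            ((summable_geometric_of_lt_one hq0.le hq1).mul_left _), tsum_mul_left,
            tsum_geometric_of_lt_one hq0.le hq1]

theorem CardCondTilde.cardCond {E : Set ℝ} {𝒥 : ℤ → Set (Set ℝ)} {C : ℝ}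
    (h : CardCondTilde E 𝒥 C) : CardCond E 𝒥 C := by
  obtain ⟨C1, hC1, h⟩ := h
  refine ⟨C1, hC1, fun k μ => ?_⟩
  have h1 := (ENNReal.le_tsum (⟨μ, le_rfl⟩ : {ν : ℕ // μ ≤ ν})).trans (h k μ)
  rw [mul_comm C1, ENNReal.ofReal_mul (by positivity), mul_assoc] at h1
  exact (ENNReal.mul_le_mul_iff_right (by simp) ENNReal.ofReal_ne_top).1 h1

/-- Lemma 8.1.1: if `E` satisfies the convexity assumption and
`N(E^k, 2^{k-n}) ≤ C 2^n (1+n)^{-β}`, then `E` satisfies `(R_p)` for every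
`p > 1 + 1/((d-1)(β+1))`, and also `(R̃_{p_d})` with `p_d = d/(d-1)`. -/
theorem regularity_of_convex_sequences (d : ℕ) (hd : 2 ≤ d)
    (E : Set ℝ) (hE : E ⊆ Set.Ioi (0:ℝ))
    (hconv : ∀ k : ℤ, ∃ t : ℕ → ℝ,
      (Monotone t ∨ Antitone t) ∧
      (Monotone (fun ν => t (ν + 1) - t ν) ∨ Antitone (fun ν => t (ν + 1) - t ν)) ∧
      (∀ ν, t ν ∈ Set.Icc ((2:ℝ) ^ k) ((2:ℝ) ^ (k + 1))) ∧
      Ek E k = Set.range t)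
    (β : ℝ) (hβ : 0 < β) (C : ℝ)
    (hN : ∀ k : ℤ, ∀ n : ℕ,
      (covN (Ek E k) ((2:ℝ) ^ (k - (n:ℤ))) : ℝ) ≤ C * (2:ℝ) ^ (n:ℝ) * (1 + (n:ℝ)) ^ (-β)) :
    (∀ p : ℝ, 1 + 1 / (((d:ℝ) - 1) * (β + 1)) < p → RegHyp E d p) ∧
      RegHypTilde E d ((d:ℝ) / ((d:ℝ) - 1)) := by
  have hC : 0 ≤ C := by
    have h1 := hN 0 0
    have h2 : (1 : ℝ) ≤ covN (Ek E 0) ((2 : ℝ) ^ ((0 : ℤ) - ((0 : ℕ) : ℤ))) := by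
      exact_mod_cast le_max_left 1 _
    norm_num at h1 h2
    linarith
  have hfam : ∀ k, ∃ F, IsRegularFamily k (Ek E k) (5 + 4 * C) (1 / (β + 1)) F := by
    intro k
    obtain ⟨t, hmono, hdiff, ht, hEt⟩ := hconv k
    have h0 : t 0 ∈ Ek E k := hEt ▸ mem_range_self 0
    rw [hEt]
    exact exists_isRegularFamily hβ hmono hdiff ht h0.2 hC (hEt ▸ hN k)
  choose 𝒥 h𝒥 using hfam
  have hd' : (0 : ℝ) < (d : ℝ) - 1 := by
    have : (2 : ℝ) ≤ d := by exact_mod_cast hd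
    linarith
  have hcore : ∀ p : ℝ, 1 + 1 / (((d : ℝ) - 1) * (β + 1)) < p → RegFamilyCore E d p 𝒥 2 := by
    intro p hp
    have h1 : 0 < 1 / (((d : ℝ) - 1) * (β + 1)) := by positivity
    refine regFamilyCore_of_isRegularFamily (by linarith) (by linarith) ?_ h𝒥
    calc 1 / (β + 1) = ((d : ℝ) - 1) * (1 / (((d : ℝ) - 1) * (β + 1))) := by field_simp
      _ < ((d : ℝ) - 1) * (p - 1) := by gcongr; linarith
  have hcard : CardCondTilde E 𝒥 2 := ⟨160, by norm_num, fun k => (h𝒥 k).tsum_card_le⟩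
  refine ⟨fun p hp => ⟨𝒥, 2, hcore p hp, hcard.cardCond⟩, 𝒥, 2, hcore _ ?_, hcard⟩
  have h1 : (d : ℝ) / ((d : ℝ) - 1) = 1 + 1 / ((d : ℝ) - 1) := by field_simp; ring
  rw [h1]
  gcongr
  exact lt_mul_of_one_lt_right hd' (by linarith)
end
end

section
/- Let E_0 = {1 + ∑_{j=1}^∞ b_j 4^{−j} : b_j ∈ {0,2} for all j} ⊂ [1,2] (the middle-halves Cantor set translated by 1). Then the shifted circular maximal operator ˜M_{E_0} on ℝ² is not of weak type (3/2, 3/2): there is no constant C such that meas({x ∈ ℝ² : ˜M_{E_0} f(x) > α}) ≤ C α^{−3/2} ‖f‖_{L^{3/2}}^{3/2} for all nonnegative continuous compactly supported f and all α > 0. -/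
open MeasureTheory Metric Set Filter
open scoped ENNReal NNReal Topology

noncomputable section

/-- The middle-halves Cantor set translated by `1`:
`E₀ = {1 + ∑_{j≥1} b_j 4^{-j} : b_j ∈ {0,2}}`. -/
def cantorMH : Set ℝ :=
  {x : ℝ | ∃ b : ℕ → ℝ, (∀ j, b j = 0 ∨ b j = 2) ∧
    x = 1 + ∑' j : ℕ, b j * (4:ℝ) ^ (-(j:ℝ) - 1)}

/-- The shifted circular maximal function
`˜M_{E₀} f (x) = sup_{r ∈ E₀} |(f * dσ)(x + r e₁)|` in `ℝ²`. -/
def shiftMax (E0 : Set ℝ) (f : Ed 2 → ℝ) (x : Ed 2) : ℝ≥0∞ :=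
  ⨆ r ∈ E0,
    (‖∫ y : sphere (0 : Ed 2) 1,
        f (x + r • (EuclideanSpace.single (0 : Fin 2) (1:ℝ)) - (y : Ed 2))
          ∂(sphereProb 2)‖₊ : ℝ≥0∞)

instance : IsProbabilityMeasure (sphereProb 2) :=
  ⟨by
    rw [sphereProb, Measure.smul_apply, smul_eq_mul]
    exact ENNReal.inv_mul_cancel (by simp [Real.pi_pos]) (measure_ne_top _ _)⟩

/-- The linear isometry of the plane that sends the first basis vector to the unit vector `p`. -/
def planeRotation (p : Ed 2) (hp : ‖p‖ = 1) : Ed 2 ≃ₗᵢ[ℝ] Ed 2 :=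
  LinearIsometry.toLinearIsometryEquiv
    { toFun := fun w => !₂[p 0 * w 0 - p 1 * w 1, p 1 * w 0 + p 0 * w 1]
      map_add' := fun v w => by
        ext i; fin_cases i <;> simp <;> ring
      map_smul' := fun c w => by
        ext i; fin_cases i <;> simp <;> ring
      norm_map' := fun w => by
        have h : p 0 ^ 2 + p 1 ^ 2 = 1 := by
          have := EuclideanSpace.norm_sq_eq p
          simpa [hp, Fin.sum_univ_two] using this.symm
        rw [EuclideanSpace.norm_eq, EuclideanSpace.norm_eq]
        congr 1
        simp only [LinearMap.coe_mk, AddHom.coe_mk, Real.norm_eq_abs, sq_abs, Fin.sum_univ_two,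
          Matrix.cons_val_zero, Matrix.cons_val_one]
        linear_combination (w 0 ^ 2 + w 1 ^ 2) * h }
    rfl

lemma planeRotation_single (p : Ed 2) (hp : ‖p‖ = 1) :
    planeRotation p hp (EuclideanSpace.single 0 1) = p := by
  ext i
  fin_cases i <;> simp [planeRotation]

open scoped Pointwise in
/-- The sector over an arc of radius `ρ` contains a rotated rectangle of sides `1/4`, `ρ/2`. -/
lemma sphereProb_cap_ge {p : Ed 2} (hp : ‖p‖ = 1) {ρ : ℝ} (hρ : 0 < ρ) (hρ1 : ρ ≤ 1) :
    ρ / (8 * Real.pi) ≤ (sphereProb 2).real {y | dist (y : Ed 2) p < ρ} := by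
  set s : Set (sphere (0 : Ed 2) 1) := {y | dist (y : Ed 2) p < ρ} with hs
  have hsm : MeasurableSet s :=
    (isOpen_lt (by fun_prop) continuous_const).measurableSet
  let L := planeRotation p hp
  let box : Set (Fin 2 → ℝ) :=
    Set.univ.pi fun i => Ioo ((![1/2, -(ρ/4)] : Fin 2 → ℝ) i) ((![3/4, ρ/4] : Fin 2 → ℝ) i)
  let R : Set (Ed 2) := L.symm ⁻¹' ((fun w : Ed 2 => w.ofLp) ⁻¹' box)
  have hbox : MeasurableSet box := MeasurableSet.univ_pi fun i => measurableSet_Ioo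
  have hR : volume R = ENNReal.ofReal (ρ / 8) := by
    rw [L.symm.measurePreserving.measure_preimage
      ((PiLp.volume_preserving_ofLp (Fin 2)).measurable hbox).nullMeasurableSet,
      (PiLp.volume_preserving_ofLp (Fin 2)).measure_preimage hbox.nullMeasurableSet,
      Real.volume_pi_Ioo, Fin.prod_univ_two, ← ENNReal.ofReal_mul (by norm_num)]
    congr 1
    simp
    ring
  have hsub : R ⊆ Ioo (0 : ℝ) 1 • ((↑) '' s : Set (Ed 2)) := by
    intro z hz
    obtain ⟨w, rfl⟩ := L.surjective z
    have hw : w.ofLp ∈ box := by simpa [R] using hz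
    have h0 := hw 0 trivial
    have h1 := hw 1 trivial
    simp only [Matrix.cons_val_zero, Matrix.cons_val_one, mem_Ioo] at h0 h1
    have hn : ‖w‖ ^ 2 = w 0 ^ 2 + w 1 ^ 2 := by
      simpa [Fin.sum_univ_two] using EuclideanSpace.norm_sq_eq w
    have hn0 := norm_nonneg w
    have hw1 : w 1 ^ 2 < ρ ^ 2 / 16 := by nlinarith
    have hlow : w 0 ≤ ‖w‖ := by nlinarith [sq_nonneg (w 1)]
    have hup : ‖w‖ < 1 := by nlinarith
    have hpos : 0 < ‖w‖ := by linarith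
    have hdiff : (w 0 - ‖w‖) ^ 2 ≤ w 1 ^ 2 := by nlinarith
    have hz : ‖L w - ‖w‖ • p‖ < ρ * ‖w‖ := by
      have : L w - ‖w‖ • p = L (w - ‖w‖ • EuclideanSpace.single 0 1) := by
        rw [map_sub, map_smul, planeRotation_single]
      rw [this, L.norm_map]
      refine lt_of_pow_lt_pow_left₀ 2 (by positivity) ?_
      rw [EuclideanSpace.norm_sq_eq]
      simp only [Fin.sum_univ_two, Real.norm_eq_abs, sq_abs]
      have hsq : 1 / 4 * ρ ^ 2 ≤ ‖w‖ ^ 2 * ρ ^ 2 := by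
        gcongr
        nlinarith
      simp
      nlinarith
    have hmem : ‖w‖⁻¹ • L w ∈ sphere (0 : Ed 2) 1 := by simp [norm_smul, hpos.ne']
    refine ⟨‖w‖, ⟨hpos, hup⟩, ‖w‖⁻¹ • L w, ⟨⟨‖w‖⁻¹ • L w, hmem⟩, ?_, rfl⟩, ?_⟩
    · have : ‖w‖⁻¹ • L w - p = ‖w‖⁻¹ • (L w - ‖w‖ • p) := by
        rw [smul_sub, smul_smul, inv_mul_cancel₀ hpos.ne', one_smul]
      simp only [hs, mem_ofPred_eq]
      rw [dist_eq_norm, this, norm_smul, norm_inv, norm_norm, inv_mul_lt_iff₀ hpos]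
      linarith
    · simp [smul_smul, hpos.ne']
  have hle : ENNReal.ofReal (ρ / 8) ≤ volume (Ioo (0 : ℝ) 1 • ((↑) '' s : Set (Ed 2))) :=
    hR ▸ measure_mono hsub
  have hfin : volume (Ioo (0 : ℝ) 1 • ((↑) '' s : Set (Ed 2))) ≠ ∞ := by
    have := measure_ne_top (volume : Measure (Ed 2)).toSphere s
    rw [Measure.toSphere_apply' _ hsm] at this
    intro h
    simp [h] at this
  have hle' : ρ / 8 ≤ (volume (Ioo (0 : ℝ) 1 • ((↑) '' s : Set (Ed 2)))).toReal :=
    (ENNReal.ofReal_le_iff_le_toReal hfin).1 hle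
  have hval : (sphereProb 2).real s
      = (2 * Real.pi)⁻¹ * (2 * (volume (Ioo (0 : ℝ) 1 • ((↑) '' s : Set (Ed 2)))).toReal) := by
    rw [measureReal_def, sphereProb, Measure.smul_apply, Measure.toSphere_apply' _ hsm,
      Measure.toSphere_apply_univ]
    simp [Real.pi_pos.le]
  rw [hval]
  calc ρ / (8 * Real.pi) = (2 * Real.pi)⁻¹ * (2 * (ρ / 8)) := by
        field_simp
    _ ≤ _ := by gcongr

/-- The numbers whose base-`4` expansion has digits `0` and `1` only: half of the middle-halves
Cantor set. -/
def binaryDigitSet : Set ℝ :=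
  {t | ∃ e : ℕ → Fin 4, (∀ j, (e j : ℕ) ≤ 1) ∧ t = Real.ofDigits e}

lemma binaryDigitSet_covering (k : ℕ) : ∃ S : Finset ℝ, S.card ≤ 2 ^ k ∧
    ∀ t ∈ binaryDigitSet, ∃ s ∈ S, |t - s| ≤ (1 / 4) ^ k := by
  classical
  let pad : (Fin k → Fin 2) → ℕ → Fin 4 :=
    fun c j => if h : j < k then (c ⟨j, h⟩).castLE (by norm_num) else 0
  refine ⟨Finset.univ.image fun c => Real.ofDigits (pad c), ?_, ?_⟩
  · exact Finset.card_image_le.trans (by simp)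
  · rintro _ ⟨e, he, rfl⟩
    refine ⟨_, Finset.mem_image_of_mem _ (Finset.mem_univ
      fun j : Fin k => (⟨e j, by have := he j; omega⟩ : Fin 2)), ?_⟩
    have := Real.abs_ofDigits_sub_ofDigits_le (x := e) (n := k)
      (y := pad fun j : Fin k => (⟨e j, by have := he j; omega⟩ : Fin 2)) ?_
    · simpa using this
    · intro i hi
      simp [pad, hi]

lemma exists_cantorMH_add_binaryDigitSet {t : ℝ} (ht : t ∈ Ico (1 : ℝ) 2) :
    ∃ r ∈ cantorMH, ∃ s ∈ binaryDigitSet, r + s = t := by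
  have ht' : t - 1 ∈ Ico (0 : ℝ) 1 := ⟨by linarith [ht.1], by linarith [ht.2]⟩
  set d := Real.digits (t - 1) 4
  let b : ℕ → Fin 4 := fun j => ⟨2 * ((d j : ℕ) / 2), by have := (d j).2; omega⟩
  let e : ℕ → Fin 4 := fun j => ⟨(d j : ℕ) % 2, by omega⟩
  refine ⟨1 + Real.ofDigits b, ⟨fun j => (b j : ℕ), ?_, ?_⟩, Real.ofDigits e,
    ⟨e, ?_, rfl⟩, ?_⟩
  · intro j
    have := (d j).2
    have : (b j : ℕ) = 0 ∨ (b j : ℕ) = 2 := by simp only [b]; omega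
    exact this.imp (fun h => by simp [h]) (fun h => by simp [h])
  · congr 1
    refine tsum_congr fun j => ?_
    rw [Real.ofDigitsTerm, ← neg_add', Real.rpow_neg (by norm_num)]
    congr 2
    exact_mod_cast (Real.rpow_natCast (4 : ℝ) (j + 1)).symm
  · intro j
    simp only [e]
    omega
  · rw [add_assoc, Real.ofDigits, Real.ofDigits,
      ← Real.summable_ofDigitsTerm.tsum_add Real.summable_ofDigitsTerm]
    have : ∀ j, Real.ofDigitsTerm b j + Real.ofDigitsTerm e j = Real.ofDigitsTerm d j := by
      intro j
      simp only [Real.ofDigitsTerm, ← add_mul]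
      congr 1
      exact_mod_cast Nat.div_add_mod (d j : ℕ) 2
    simp only [this]
    have := Real.ofDigits_digits (b := 4) (by norm_num) ht'
    rw [Real.ofDigits] at this
    rw [this]
    ring

/-- The reflected half-size Cantor set on the first coordinate axis. -/
def axisCantor : Set (Ed 2) := (fun t : ℝ => EuclideanSpace.single 0 (-t)) '' binaryDigitSet

lemma axisCantor_nonempty : axisCantor.Nonempty :=
  Set.Nonempty.image _ ⟨_, fun _ => 0, by simp, rfl⟩

lemma norm_le_one_of_mem_axisCantor {w : Ed 2} (hw : w ∈ axisCantor) : ‖w‖ ≤ 1 := by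
  obtain ⟨_, ⟨e, -, rfl⟩, rfl⟩ := hw
  simpa [abs_of_nonneg (Real.ofDigits_nonneg e)] using Real.ofDigits_le_one e

lemma volume_thickening_axisCantor_le (k : ℕ) :
    volume.real {z : Ed 2 | infDist z axisCantor < 2 * (1 / 4) ^ k}
      ≤ 9 * Real.pi * (1 / 8) ^ k := by
  obtain ⟨S, hS, hcov⟩ := binaryDigitSet_covering k
  have hsub : {z : Ed 2 | infDist z axisCantor < 2 * (1 / 4) ^ k}
      ⊆ ⋃ s ∈ S, ball (EuclideanSpace.single 0 (-s) : Ed 2) (3 * (1 / 4) ^ k) := by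
    intro z hz
    obtain ⟨_, ⟨t, ht, rfl⟩, hd⟩ := (infDist_lt_iff axisCantor_nonempty).1 hz
    obtain ⟨s, hs, hts⟩ := hcov t ht
    simp only [mem_iUnion, mem_ball]
    refine ⟨s, hs, (dist_triangle _ (EuclideanSpace.single 0 (-t)) _).trans_lt ?_⟩
    have : dist (EuclideanSpace.single 0 (-t) : Ed 2) (EuclideanSpace.single 0 (-s))
        ≤ (1 / 4) ^ k := by
      rw [PiLp.dist_single_same, dist_neg_neg]
      exact hts
    linarith
  have hfin : volume (⋃ s ∈ S, ball (EuclideanSpace.single 0 (-s) : Ed 2) (3 * (1 / 4) ^ k)) ≠ ∞ :=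
    ((measure_biUnion_lt_top S.finite_toSet fun _ _ => measure_ball_lt_top)).ne
  have hball : ∀ s : ℝ, volume.real (ball (EuclideanSpace.single 0 (-s) : Ed 2) (3 * (1 / 4) ^ k))
      = 9 * Real.pi * (1 / 16) ^ k := by
    intro s
    rw [measureReal_def, EuclideanSpace.volume_ball_fin_two]
    rw [ENNReal.toReal_mul, ENNReal.toReal_pow, ENNReal.toReal_ofReal (by positivity)]
    rw [mul_pow, ← pow_mul, mul_comm k 2, pow_mul]
    norm_num [Real.pi_pos.le]
    ring
  calc _ ≤ volume.real (⋃ s ∈ S, ball (EuclideanSpace.single 0 (-s) : Ed 2) (3 * (1 / 4) ^ k)) :=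
        measureReal_mono hsub hfin
    _ ≤ ∑ s ∈ S, volume.real (ball (EuclideanSpace.single 0 (-s) : Ed 2) (3 * (1 / 4) ^ k)) :=
        measureReal_biUnion_finset_le _ _
    _ = S.card * (9 * Real.pi * (1 / 16) ^ k) := by
        simp only [hball, Finset.sum_const, nsmul_eq_mul]
    _ ≤ 2 ^ k * (9 * Real.pi * (1 / 16) ^ k) := by
        gcongr
        exact_mod_cast hS
    _ = 9 * Real.pi * (1 / 8) ^ k := by
        rw [mul_left_comm, ← mul_pow]
        norm_num

/-- A continuous bump equal to `1` within `4⁻ᵏ` of `axisCantor` and to `0` beyond `2 · 4⁻ᵏ`. -/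
def cantorBump (k : ℕ) (z : Ed 2) : ℝ := max 0 (min 1 (2 - 4 ^ k * infDist z axisCantor))

lemma continuous_cantorBump (k : ℕ) : Continuous (cantorBump k) := by
  unfold cantorBump
  have := continuous_infDist_pt axisCantor
  fun_prop

lemma cantorBump_nonneg (k : ℕ) (z : Ed 2) : 0 ≤ cantorBump k z := le_max_left _ _

lemma cantorBump_le_one (k : ℕ) (z : Ed 2) : cantorBump k z ≤ 1 :=
  max_le zero_le_one (min_le_left _ _)

lemma cantorBump_eq_zero {k : ℕ} {z : Ed 2} (h : 2 * (1 / 4) ^ k ≤ infDist z axisCantor) :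
    cantorBump k z = 0 := by
  refine max_eq_left ((min_le_right _ _).trans ?_)
  have : (4 : ℝ) ^ k * (2 * (1 / 4) ^ k) ≤ 4 ^ k * infDist z axisCantor := by gcongr
  rw [mul_left_comm, ← mul_pow] at this
  norm_num at this
  linarith

lemma cantorBump_eq_one {k : ℕ} {z : Ed 2} (h : infDist z axisCantor ≤ (1 / 4) ^ k) :
    cantorBump k z = 1 := by
  have : (4 : ℝ) ^ k * infDist z axisCantor ≤ 4 ^ k * (1 / 4) ^ k := by gcongr
  rw [← mul_pow] at this
  norm_num at this
  rw [cantorBump, min_eq_left (by linarith), max_eq_right zero_le_one]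

/-- A truncation at height `4ⁿ` of the reciprocal of the distance to `axisCantor`. -/
def cantorPeak (n : ℕ) (z : Ed 2) : ℝ := ∑ k ∈ Finset.range n, 4 ^ k * cantorBump k z

lemma continuous_cantorPeak (n : ℕ) : Continuous (cantorPeak n) :=
  continuous_finsetSum _ fun k _ => continuous_const.mul (continuous_cantorBump k)

lemma cantorPeak_nonneg (n : ℕ) (z : Ed 2) : 0 ≤ cantorPeak n z :=
  Finset.sum_nonneg fun k _ => mul_nonneg (by positivity) (cantorBump_nonneg k z)

lemma setOf_infDist_axisCantor_lt_subset (k : ℕ) :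
    {z : Ed 2 | infDist z axisCantor < 2 * (1 / 4) ^ k} ⊆ closedBall 0 3 := by
  intro z hz
  obtain ⟨w, hw, hd⟩ := (infDist_lt_iff axisCantor_nonempty).1 hz
  have h1 := norm_le_one_of_mem_axisCantor hw
  have h2 : ((1 : ℝ) / 4) ^ k ≤ 1 := pow_le_one₀ (by norm_num) (by norm_num)
  have h3 := norm_le_norm_add_norm_sub' z w
  rw [dist_eq_norm] at hd
  rw [mem_closedBall_zero_iff]
  linarith

lemma hasCompactSupport_cantorPeak (n : ℕ) : HasCompactSupport (cantorPeak n) := by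
  refine HasCompactSupport.intro (isCompact_closedBall (0 : Ed 2) 3) fun z hz => ?_
  refine Finset.sum_eq_zero fun k _ => ?_
  rw [cantorBump_eq_zero, mul_zero]
  by_contra! h
  exact hz (setOf_infDist_axisCantor_lt_subset k h)

lemma rpow_three_halves_le {x : ℝ} {n : ℕ} (hx : 0 ≤ x) (h : x ≤ 4 ^ n) :
    x ^ (3 / 2 : ℝ) ≤ 8 ^ n := by
  calc x ^ (3 / 2 : ℝ) ≤ ((4 : ℝ) ^ n) ^ (3 / 2 : ℝ) :=
        Real.rpow_le_rpow hx h (by norm_num)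
    _ = 8 ^ n := by
        rw [← Real.rpow_natCast, ← Real.rpow_natCast, ← Real.rpow_mul (by norm_num), mul_comm,
          Real.rpow_mul (by norm_num)]
        congr 1
        rw [show (4 : ℝ) = 2 ^ (2 : ℝ) by norm_num, ← Real.rpow_mul (by norm_num)]
        norm_num

lemma cantorPeak_le (n : ℕ) (z : Ed 2) : cantorPeak n z ≤ 4 ^ n := by
  induction n with
  | zero => simp [cantorPeak]
  | succ n ih =>
    rw [cantorPeak, Finset.sum_range_succ]
    change cantorPeak n z + _ ≤ _
    have := mul_le_mul_of_nonneg_left (cantorBump_le_one n z)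
      (pow_nonneg (by norm_num : (0:ℝ) ≤ 4) n)
    rw [pow_succ]
    linarith [pow_nonneg (by norm_num : (0:ℝ) ≤ 4) n]

lemma cantorPeak_rpow_le (n : ℕ) (z : Ed 2) :
    cantorPeak n z ^ (3 / 2 : ℝ) ≤ ∑ k ∈ Finset.range n,
      {z : Ed 2 | infDist z axisCantor < 2 * (1 / 4) ^ k}.indicator (fun _ => 8 * 8 ^ k) z := by
  induction n with
  | zero => simp [cantorPeak]
  | succ n ih =>
    rw [Finset.sum_range_succ]
    by_cases h : infDist z axisCantor < 2 * (1 / 4) ^ n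
    · rw [indicator_of_mem (s := {z : Ed 2 | infDist z axisCantor < 2 * (1 / 4) ^ n}) h]
      refine (rpow_three_halves_le (cantorPeak_nonneg _ z) (cantorPeak_le _ z)).trans ?_
      rw [pow_succ']
      exact le_add_of_nonneg_left (Finset.sum_nonneg fun k _ =>
        indicator_nonneg (fun _ _ => by positivity) _)
    · rw [indicator_of_notMem (s := {z : Ed 2 | infDist z axisCantor < 2 * (1 / 4) ^ n}) h,
        add_zero, cantorPeak, Finset.sum_range_succ, cantorBump_eq_zero (not_lt.1 h), mul_zero,
        add_zero]
      exact ih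

lemma integral_cantorPeak_rpow_le (n : ℕ) :
    ∫ z, cantorPeak n z ^ (3 / 2 : ℝ) ≤ 72 * Real.pi * n := by
  have hm : ∀ k : ℕ, MeasurableSet {z : Ed 2 | infDist z axisCantor < 2 * (1 / 4) ^ k} := fun k =>
    (isOpen_lt (continuous_infDist_pt axisCantor) continuous_const).measurableSet
  have hint : ∀ k : ℕ, Integrable
      ({z : Ed 2 | infDist z axisCantor < 2 * (1 / 4) ^ k}.indicator
        fun _ => (8 * 8 ^ k : ℝ)) volume := fun k =>
    (integrable_indicator_iff (hm k)).2 (integrableOn_const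
      ((measure_mono (setOf_infDist_axisCantor_lt_subset k)).trans_lt measure_closedBall_lt_top).ne)
  calc ∫ z, cantorPeak n z ^ (3 / 2 : ℝ)
      ≤ ∫ z, ∑ k ∈ Finset.range n,
        {z : Ed 2 | infDist z axisCantor < 2 * (1 / 4) ^ k}.indicator (fun _ => 8 * 8 ^ k) z :=
        integral_mono_of_nonneg
          (Eventually.of_forall fun z => Real.rpow_nonneg (cantorPeak_nonneg n z) _)
          (integrable_finsetSum _ fun k _ => hint k)
          (Eventually.of_forall (cantorPeak_rpow_le n))
    _ = ∑ k ∈ Finset.range n,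
        volume.real {z : Ed 2 | infDist z axisCantor < 2 * (1 / 4) ^ k} * (8 * 8 ^ k) := by
        rw [integral_finsetSum _ fun k _ => hint k]
        refine Finset.sum_congr rfl fun k _ => ?_
        rw [integral_indicator_const _ (hm k), smul_eq_mul]
    _ ≤ ∑ k ∈ Finset.range n, 9 * Real.pi * (1 / 8) ^ k * (8 * 8 ^ k) := by
        gcongr with k
        exact volume_thickening_axisCantor_le k
    _ = ∑ k ∈ Finset.range n, 72 * Real.pi := by
        refine Finset.sum_congr rfl fun k _ => ?_
        rw [one_div, inv_pow]
        field_simp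
        norm_num
    _ = 72 * Real.pi * n := by simp [mul_comm]

/-- If the unit circle about `x` meets `axisCantor`, each of the `n` scales contributes a fixed
amount to the circular average. -/
lemma integral_sphere_cantorPeak_ge (n : ℕ) {x p : Ed 2} (hp : ‖p‖ = 1)
    (hx : x - p ∈ axisCantor) :
    n / (8 * Real.pi) ≤ ∫ y : sphere (0 : Ed 2) 1, cantorPeak n (x - y) ∂(sphereProb 2) := by
  have hint : ∀ k : ℕ, Integrable (fun y : sphere (0 : Ed 2) 1 => 4 ^ k * cantorBump k (x - y))
      (sphereProb 2) := fun k =>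
    Continuous.integrable_of_hasCompactSupport
      (continuous_const.mul ((continuous_cantorBump k).comp (by fun_prop)))
      (HasCompactSupport.of_compactSpace _)
  have hterm : ∀ k : ℕ, 1 / (8 * Real.pi)
      ≤ ∫ y : sphere (0 : Ed 2) 1, 4 ^ k * cantorBump k (x - y) ∂(sphereProb 2) := by
    intro k
    let s : Set (sphere (0 : Ed 2) 1) := {y | dist (y : Ed 2) p < (1 / 4) ^ k}
    have hsm : MeasurableSet s :=
      (isOpen_lt (by fun_prop) continuous_const).measurableSet
    calc 1 / (8 * Real.pi) = 4 ^ k * ((1 / 4) ^ k / (8 * Real.pi)) := by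
          rw [← mul_div_assoc, ← mul_pow]
          norm_num
      _ ≤ 4 ^ k * (sphereProb 2).real s := by
          gcongr
          exact sphereProb_cap_ge hp (by positivity) (pow_le_one₀ (by norm_num) (by norm_num))
      _ = ∫ y, s.indicator (fun _ => (4 : ℝ) ^ k) y ∂(sphereProb 2) := by
          rw [integral_indicator_const _ hsm, smul_eq_mul, mul_comm]
      _ ≤ _ := by
          refine integral_mono ((integrable_const _).indicator hsm) (hint k)
            (indicator_le' (fun y hy => ?_) fun y _ => ?_)
          · rw [cantorBump_eq_one, mul_one]
            refine (infDist_le_dist_of_mem hx).trans ?_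
            rw [dist_sub_left]
            exact le_of_lt hy
          · exact mul_nonneg (by positivity) (cantorBump_nonneg _ _)
  unfold cantorPeak
  rw [integral_finsetSum _ fun k _ => hint k]
  calc n / (8 * Real.pi) = ∑ k ∈ Finset.range n, 1 / (8 * Real.pi) := by simp [div_eq_mul_inv]
    _ ≤ _ := Finset.sum_le_sum fun k _ => hterm k

/-- A rectangle on which the maximal function of every `cantorPeak n` is large. -/
def cantorRectangle : Set (Ed 2) := {x | x 0 ∈ Ioo (-1 : ℝ) (-1/2) ∧ x 1 ∈ Ioo (-1/2 : ℝ) (1/2)}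

lemma volume_cantorRectangle_pos : 0 < volume cantorRectangle := by
  have ho : IsOpen cantorRectangle :=
    (isOpen_Ioo.preimage (by fun_prop : Continuous fun x : Ed 2 => x 0)).inter
      (isOpen_Ioo.preimage (by fun_prop : Continuous fun x : Ed 2 => x 1))
  refine ho.measure_pos volume ⟨!₂[-3/4, 0], ?_⟩
  norm_num [cantorRectangle]

lemma shiftMax_cantorPeak_ge (n : ℕ) {x : Ed 2} (hx : x ∈ cantorRectangle) :
    ENNReal.ofReal (n / (8 * Real.pi)) ≤ shiftMax cantorMH (cantorPeak n) x := by
  obtain ⟨⟨h0, h0'⟩, h1, h1'⟩ := hx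
  set q := √(1 - x 1 ^ 2)
  have hnn : 0 ≤ 1 - x 1 ^ 2 := by nlinarith
  have hq2 : q ^ 2 = 1 - x 1 ^ 2 := Real.sq_sqrt hnn
  have hq0 : 0 ≤ q := Real.sqrt_nonneg _
  have hp : ‖(!₂[q, x 1] : Ed 2)‖ = 1 := by
    rw [EuclideanSpace.norm_eq]
    simp [Fin.sum_univ_two, hq2]
  obtain ⟨r, hr, s, hs, hrs⟩ := exists_cantorMH_add_binaryDigitSet (t := q - x 0)
    ⟨by nlinarith, by nlinarith [sq_nonneg (x 1)]⟩
  have hmem : x + r • EuclideanSpace.single (0 : Fin 2) (1 : ℝ) - !₂[q, x 1] ∈ axisCantor := by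
    refine ⟨s, hs, ?_⟩
    ext i
    fin_cases i
    · simp
      linarith
    · simp
  refine le_trans ?_ (le_iSup₂ (f := fun r (_ : r ∈ cantorMH) =>
    (‖∫ y : sphere (0 : Ed 2) 1, cantorPeak n
      (x + r • (EuclideanSpace.single (0 : Fin 2) (1:ℝ)) - (y : Ed 2)) ∂(sphereProb 2)‖₊ : ℝ≥0∞))
    r hr)
  rw [← enorm_eq_nnnorm, ← ofReal_norm]
  exact ENNReal.ofReal_le_ofReal
    ((integral_sphere_cantorPeak_ge n hp hmem).trans (le_abs_self _))

/-- §8.2: the shifted circular maximal operator associated to the middle-halves Cantor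
set is not of weak type `(3/2, 3/2)`. -/
theorem shifted_circular_maximal_not_weak_type :
    ¬ ∃ C : ℝ, ∀ f : Ed 2 → ℝ, Continuous f → HasCompactSupport f → (∀ x, 0 ≤ f x) →
        ∀ a : ℝ, 0 < a →
          volume {x | ENNReal.ofReal a < shiftMax cantorMH f x} ≤
            ENNReal.ofReal (C * a ^ (-(3/2 : ℝ)) * ∫ x, (f x) ^ ((3:ℝ)/2)) := by
  rintro ⟨C, hC⟩
  set K := |C| * (1 / (16 * Real.pi)) ^ (-(3 / 2) : ℝ) * (72 * Real.pi)
  have hbound : ∀ n : ℕ, 0 < n →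
      volume cantorRectangle ≤ ENNReal.ofReal (K * (n : ℝ) ^ (-(1 / 2) : ℝ)) := by
    intro n hn
    have hn' : (0 : ℝ) < n := by exact_mod_cast hn
    have hpi := Real.pi_pos
    have ha : 0 < 1 / (16 * Real.pi) * n := by positivity
    have h := hC (cantorPeak n) (continuous_cantorPeak n) (hasCompactSupport_cantorPeak n)
      (cantorPeak_nonneg n) (1 / (16 * Real.pi) * n) ha
    refine (measure_mono fun x hx => ?_).trans (h.trans (ENNReal.ofReal_le_ofReal ?_))
    · refine lt_of_lt_of_le ?_ (shiftMax_cantorPeak_ge n hx)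
      rw [ENNReal.ofReal_lt_ofReal_iff (by positivity)]
      have : (n : ℝ) / (8 * Real.pi) = 2 * (1 / (16 * Real.pi) * n) := by
        field_simp
        norm_num
      linarith
    · calc _ ≤ |C| * (1 / (16 * Real.pi) * n) ^ (-(3 / 2) : ℝ) * (72 * Real.pi * n) := by
            refine mul_le_mul ?_ (integral_cantorPeak_rpow_le n) ?_ (by positivity)
            · gcongr
              exact le_abs_self C
            · exact integral_nonneg fun z => Real.rpow_nonneg (cantorPeak_nonneg n z) _
        _ = K * ((n : ℝ) ^ (-(3 / 2) : ℝ) * (n : ℝ) ^ (1 : ℝ)) := by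
            rw [Real.mul_rpow (by positivity) hn'.le, Real.rpow_one]
            ring
        _ = K * (n : ℝ) ^ (-(1 / 2) : ℝ) := by
            rw [← Real.rpow_add hn']
            norm_num
  have hlim : Tendsto (fun n : ℕ => ENNReal.ofReal (K * (n : ℝ) ^ (-(1 / 2) : ℝ))) atTop (𝓝 0) := by
    have := ((tendsto_rpow_neg_atTop (by norm_num : (0 : ℝ) < 1 / 2)).comp
      tendsto_natCast_atTop_atTop).const_mul K
    simpa using ENNReal.tendsto_ofReal this
  exact volume_cantorRectangle_pos.not_ge
    (ge_of_tendsto hlim ((eventually_gt_atTop 0).mono hbound))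
end
end
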